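/- For every m ∈ ℕ there exists N ∈ ℕ such that for all a_1,…,a_5 ≥ N, dim_k (R/M_5)_{mℓ + a_1ε_1 + … + a_5ε_5} = (m+2 choose 2). -/

import Mathlib

open MvPolynomial

/- The polynomial ring `R` in the 16 variables `e₁,…,e₅`, `f_ij` (`1 ≤ i < j ≤ 5`), `g` is
modelled as `MvPolynomial (Fin 16) k`, with
`e₁ = X 0, …, e₅ = X 4`,
`f₁₂ = X 5, f₁₃ = X 6, f₁₄ = X 7, f₁₅ = X 8, f₂₃ = X 9, f₂₄ = X 10, f₂₅ = X 11,
 f₃₄ = X 12, f₃₅ = X 13, f₄₅ = X 14`, `g = X 15`.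
The grading group is `ℤ⁶` with basis `ℓ, ε₁, …, ε₅` (coordinate 0 is the `ℓ`-coordinate);
`deg eᵢ = εᵢ`, `deg f_ij = ℓ − εᵢ − εⱼ`, `deg g = 2ℓ − ε₁ − ⋯ − ε₅`. -/
def deg5 : Fin 16 → Fin 6 → ℤ :=
  ![![0,1,0,0,0,0], ![0,0,1,0,0,0], ![0,0,0,1,0,0], ![0,0,0,0,1,0], ![0,0,0,0,0,1],
    ![1,-1,-1,0,0,0], ![1,-1,0,-1,0,0], ![1,-1,0,0,-1,0], ![1,-1,0,0,0,-1],
    ![1,0,-1,-1,0,0], ![1,0,-1,0,-1,0], ![1,0,-1,0,0,-1],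
    ![1,0,0,-1,-1,0], ![1,0,0,-1,0,-1], ![1,0,0,0,-1,-1],
    ![2,-1,-1,-1,-1,-1]]

/-- The monomial ideal `M₅`, generated by the 20 quadratic monomials
`e₄f₁₄, e₃f₁₃, e₄f₂₄, e₃f₂₃, e₄f₃₄, e₂f₂₃, e₂f₂₄, e₁f₁₄, e₂f₂₅, e₁f₁₅, f₂₄f₁₃, f₁₄f₂₃, e₄g,
f₁₃f₂₅, e₃g, f₂₄f₁₅, e₂g, f₁₅f₃₄, e₁g, f₂₅f₃₄`. -/
noncomputable def M5 (k : Type*) [Field k] : Ideal (MvPolynomial (Fin 16) k) :=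
  Ideal.span
    {X 3 * X 7, X 2 * X 6, X 3 * X 10, X 2 * X 9, X 3 * X 12,
     X 1 * X 9, X 1 * X 10, X 0 * X 7, X 1 * X 11, X 0 * X 8,
     X 10 * X 6, X 7 * X 9, X 3 * X 15, X 6 * X 11, X 2 * X 15,
     X 10 * X 8, X 1 * X 15, X 8 * X 12, X 0 * X 15, X 11 * X 12}

/-- The `P`-degree of a monomial for the grading `deg`. -/
def mdeg {n : ℕ} {P : Type*} [AddCommMonoid P] (deg : Fin n → P) (a : Fin n →₀ ℕ) : P :=
  a.sum fun i e => e • deg i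

/-- The `k`-span of the monomials of degree `D`. -/
noncomputable def degSub {k : Type*} [Field k] {n : ℕ} {P : Type*} [AddCommMonoid P]
    (deg : Fin n → P) (D : P) : Submodule k (MvPolynomial (Fin n) k) :=
  Submodule.span k
    ((fun a => (monomial a (1 : k) : MvPolynomial (Fin n) k)) '' { a | mdeg deg a = D })

/-- The degree-`D` piece `(R/Q)_D` of the quotient. -/
noncomputable def quotPiece {k : Type*} [Field k] {n : ℕ} {P : Type*} [AddCommMonoid P]
    (Q : Ideal (MvPolynomial (Fin n) k)) (deg : Fin n → P) (D : P) :
    Submodule k (MvPolynomial (Fin n) k ⧸ Submodule.restrictScalars k Q) :=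
  Submodule.map (Submodule.restrictScalars k Q).mkQ (degSub deg D)

/-- The degree `mℓ + a₁ε₁ + ⋯ + a₅ε₅`. -/
def Dv5 (m : ℕ) (a : Fin 5 → ℕ) : Fin 6 → ℤ :=
  ![(m : ℤ), (a 0 : ℤ), (a 1 : ℤ), (a 2 : ℤ), (a 3 : ℤ), (a 4 : ℤ)]

/-- The degree-`D` piece of the quotient by a monomial ideal has as dimension the number of
standard monomials of degree `D`. -/
theorem finrank_quotPiece_span_monomial {k : Type*} [Field k] {n : ℕ} {P : Type*}
    [AddCommMonoid P] (S : Set (Fin n →₀ ℕ)) (deg : Fin n → P) (D : P) :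
    Module.finrank k (quotPiece
      (Ideal.span ((fun s => (monomial s (1 : k) : MvPolynomial (Fin n) k)) '' S)) deg D) =
      { a | mdeg deg a = D ∧ ∀ s ∈ S, ¬ s ≤ a }.ncard := by
  set I := Ideal.span ((fun s => (monomial s (1 : k) : MvPolynomial (Fin n) k)) '' S)
  set T : Set (Fin n →₀ ℕ) := { a | mdeg deg a = D ∧ ∀ s ∈ S, ¬ s ≤ a }
  let v : T → MvPolynomial (Fin n) k := fun a => monomial a.1 1
  have hrange : Set.range v = (fun a => (monomial a (1 : k) : MvPolynomial (Fin n) k)) '' T := by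
    ext p
    simp [v]
  have hv : LinearIndependent k v := by
    have h := (basisMonomials (Fin n) k).linearIndependent.comp
      (Subtype.val : T → _) Subtype.val_injective
    have hcomp : v = basisMonomials (Fin n) k ∘ Subtype.val := by
      ext1 a
      simp [v]
    rw [hcomp]
    exact h
  have hdisj : Disjoint (Submodule.span k (Set.range v))
      (LinearMap.ker (Submodule.restrictScalars k I).mkQ) := by
    rw [Submodule.ker_mkQ, Submodule.disjoint_def, hrange, ← restrictSupport_eq_span]
    intro p hp hpI
    rw [mem_restrictSupport_iff] at hp
    rw [Submodule.restrictScalars_mem, mem_ideal_span_monomial_image] at hpI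
    rw [← support_eq_empty, Finset.eq_empty_iff_forall_notMem]
    intro a ha
    obtain ⟨s, hs, hsa⟩ := hpI a ha
    exact (hp ha).2 s hs hsa
  have hspan : quotPiece I deg D =
      Submodule.span k (Set.range ((Submodule.restrictScalars k I).mkQ ∘ v)) := by
    rw [Set.range_comp, hrange, quotPiece, degSub, Submodule.map_span]
    apply le_antisymm
    · rw [Submodule.span_le]
      rintro _ ⟨_, ⟨a, ha, rfl⟩, rfl⟩
      by_cases h : ∃ s ∈ S, s ≤ a
      · have hmem : (monomial a (1 : k)) ∈ I := by
          rw [mem_ideal_span_monomial_image]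
          intro b hb
          rw [Finset.mem_singleton.mp (support_monomial_subset hb)]
          exact h
        have h0 : (Submodule.restrictScalars k I).mkQ (monomial a 1) = 0 := by
          rw [Submodule.mkQ_apply, Submodule.Quotient.mk_eq_zero]
          exact hmem
        exact h0 ▸ Submodule.zero_mem _
      · push Not at h
        exact Submodule.subset_span ⟨_, ⟨a, ⟨ha, h⟩, rfl⟩, rfl⟩
    · exact Submodule.span_mono (Set.image_mono (Set.image_mono fun a ha => ha.1))
  have hcard := rank_span (hv.map hdisj)
  rw [hspan, Module.finrank, hcard]
  exact Nat.card_range_of_injective (hv.map hdisj).injective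

/-- The pairs of variables whose products generate `M5`. -/
def M5Pairs : Set (Fin 16 × Fin 16) :=
  {(3, 7), (2, 6), (3, 10), (2, 9), (3, 12), (1, 9), (1, 10), (0, 7), (1, 11), (0, 8),
   (10, 6), (7, 9), (3, 15), (6, 11), (2, 15), (10, 8), (1, 15), (8, 12), (0, 15), (11, 12)}

/-- The exponent vectors of the generators of `M5`. -/
noncomputable def M5Exponents : Set (Fin 16 →₀ ℕ) :=
  (fun p => Finsupp.single p.1 1 + Finsupp.single p.2 1) '' M5Pairs

theorem M5_eq_span_monomial (k : Type*) [Field k] :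
    M5 k = Ideal.span
      ((fun s => (monomial s (1 : k) : MvPolynomial (Fin 16) k)) '' M5Exponents) := by
  simp only [M5, M5Exponents, M5Pairs, Set.image_insert_eq, Set.image_singleton,
    X, monomial_mul, one_mul]

theorem single_add_single_le_iff {σ : Type*} {i j : σ} (h : i ≠ j) (a : σ →₀ ℕ) :
    Finsupp.single i 1 + Finsupp.single j 1 ≤ a ↔ a i ≠ 0 ∧ a j ≠ 0 := by
  classical
  constructor
  · intro hle
    have hi := hle i
    have hj := hle j
    simp [h, h.symm] at hi hj
    omega
  · rintro ⟨hi, hj⟩ x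
    simp only [Finsupp.add_apply, Finsupp.single_apply]
    split_ifs with h1 h2 h2
    · exact absurd (h1.trans h2.symm) h
    · subst h1; omega
    · subst h2; omega
    · omega

theorem forall_M5Exponents_not_le_iff (a : Fin 16 →₀ ℕ) :
    (∀ s ∈ M5Exponents, ¬ s ≤ a) ↔ ∀ p ∈ M5Pairs, a p.1 = 0 ∨ a p.2 = 0 := by
  have hne : ∀ p ∈ M5Pairs, p.1 ≠ p.2 := by
    simp [M5Pairs]
  rw [M5Exponents, Set.forall_mem_image]
  refine forall₂_congr fun p hp => ?_
  rw [single_add_single_le_iff (hne p hp)]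
  tauto

theorem mdeg_deg5_eq_Dv5_iff (b : Fin 16 →₀ ℕ) (m : ℕ) (a : Fin 5 → ℕ) :
    mdeg deg5 b = Dv5 m a ↔
      b 5 + b 6 + b 7 + b 8 + b 9 + b 10 + b 11 + b 12 + b 13 + b 14 + 2 * b 15 = m ∧
      b 0 = a 0 + b 5 + b 6 + b 7 + b 8 + b 15 ∧
      b 1 = a 1 + b 5 + b 9 + b 10 + b 11 + b 15 ∧
      b 2 = a 2 + b 6 + b 9 + b 12 + b 13 + b 15 ∧
      b 3 = a 3 + b 7 + b 10 + b 12 + b 14 + b 15 ∧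
      b 4 = a 4 + b 8 + b 11 + b 13 + b 14 + b 15 := by
  rw [mdeg, Finsupp.sum_fintype _ _ (by simp), funext_iff]
  simp [Fin.forall_fin_succ, Fin.sum_univ_succ, deg5, Dv5]
  omega

/-- The triples of natural numbers with sum `m`, as nested pairs. -/
def triples (m : ℕ) : Finset (Σ _ : ℕ × ℕ, ℕ × ℕ) :=
  (Finset.HasAntidiagonal.antidiagonal m).sigma fun p => Finset.HasAntidiagonal.antidiagonal p.1

theorem card_triples (m : ℕ) : (triples m).card = Nat.choose (m + 2) 2 := by
  simp only [triples, Finset.card_sigma, Finset.Nat.card_antidiagonal]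
  rw [Finset.Nat.sum_antidiagonal_eq_sum_range_succ fun i _ => i + 1]
  induction m with
  | zero => rfl
  | succ m ih =>
    have h : (m + 1 + 2).choose 2 = m + 2 + (m + 2).choose 2 := by
      rw [Nat.choose_succ_succ' (m + 2) 1, Nat.choose_one_right]
    rw [Finset.sum_range_succ, ih, h]
    omega

/-- The exponent vector of degree `Dv5 m a` whose `f₁₂, f₃₅, f₄₅` exponents are given by a triple,
and in which no other `f_ij` nor `g` occurs. -/
noncomputable def standardExponent (a : Fin 5 → ℕ) (t : Σ _ : ℕ × ℕ, ℕ × ℕ) : Fin 16 →₀ ℕ :=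
  Finsupp.equivFunOnFinite.symm
    ![a 0 + t.2.1, a 1 + t.2.1, a 2 + t.2.2, a 3 + t.1.2, a 4 + t.2.2 + t.1.2,
      t.2.1, 0, 0, 0, 0, 0, 0, 0, t.2.2, t.1.2, 0]

theorem setOf_standard_eq_image (m : ℕ) (a : Fin 5 → ℕ) (ha : ∀ i, 1 ≤ a i) :
    { b | mdeg deg5 b = Dv5 m a ∧ ∀ s ∈ M5Exponents, ¬ s ≤ b } =
      standardExponent a '' (triples m : Set (Σ _ : ℕ × ℕ, ℕ × ℕ)) := by
  have h0 := ha 0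
  have h1 := ha 1
  have h2 := ha 2
  have h3 := ha 3
  ext b
  simp only [Set.mem_ofPred_eq, mdeg_deg5_eq_Dv5_iff, forall_M5Exponents_not_le_iff]
  constructor
  · rintro ⟨⟨hm, e0, e1, e2, e3, e4⟩, hb⟩
    simp only [M5Pairs, Set.mem_insert_iff, Set.mem_singleton_iff, forall_eq_or_imp,
      forall_eq] at hb
    have hz : b 6 = 0 ∧ b 7 = 0 ∧ b 8 = 0 ∧ b 9 = 0 ∧ b 10 = 0 ∧ b 11 = 0 ∧ b 12 = 0 ∧
        b 15 = 0 := by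
      omega
    clear hb
    obtain ⟨z6, z7, z8, z9, z10, z11, z12, z15⟩ := hz
    refine ⟨⟨(b 5 + b 13, b 14), (b 5, b 13)⟩, ?_, ?_⟩
    · simp [triples]
      omega
    · ext i
      fin_cases i <;> simp [standardExponent] <;> omega
  · rintro ⟨⟨⟨p, q⟩, ⟨r, s⟩⟩, ht, rfl⟩
    simp [triples] at ht
    constructor
    · simp [standardExponent]
      omega
    · simp only [M5Pairs, Set.mem_insert_iff, Set.mem_singleton_iff, forall_eq_or_imp, forall_eq]
      simp [standardExponent]

theorem standardExponent_injOn (a : Fin 5 → ℕ) (m : ℕ) :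
    Set.InjOn (standardExponent a) (triples m : Set (Σ _ : ℕ × ℕ, ℕ × ℕ)) := by
  rintro ⟨⟨p, q⟩, ⟨r, s⟩⟩ ht ⟨⟨p', q'⟩, ⟨r', s'⟩⟩ ht' h
  simp [triples] at ht ht'
  have h5 := DFunLike.congr_fun h 5
  have h13 := DFunLike.congr_fun h 13
  have h14 := DFunLike.congr_fun h 14
  simp [standardExponent] at h5 h13 h14
  obtain rfl : p = p' := by omega
  simp [h5, h13, h14]

/-- For every `m` and all `a₁,…,a₅ ≫ 0`,
`dim_k (R/M₅)_{mℓ+a₁ε₁+⋯+a₅ε₅} = (m+2 choose 2)`. -/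
theorem stmt13 {k : Type*} [Field k] (m : ℕ) :
    ∃ N : ℕ, ∀ a : Fin 5 → ℕ, (∀ i, N ≤ a i) →
      Module.finrank k (quotPiece (M5 k) deg5 (Dv5 m a)) = Nat.choose (m + 2) 2 := by
  refine ⟨1, fun a ha => ?_⟩
  rw [M5_eq_span_monomial, finrank_quotPiece_span_monomial, setOf_standard_eq_image m a ha,
    (standardExponent_injOn a m).ncard_image, Set.ncard_coe_finset, card_triples]
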